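/- arXiv:2502.03306 — 2 statements merged into one kernel-verified Lean document; each statement's English description precedes it below -/
import Mathlib

section
/- As sl2(C)-representations, Λ^4 (n W_2) ≅ (n/2)·C(n+1,3) · W_1 ⊕ 3·C(n+1,4) · W_3 ⊕ C(n,4) · W_5. -/
open LieAlgebra.SpecialLinear

/-- `E` together with its `sl₂(ℂ)`-module structure is (a model of) the `r`-th exterior
power `Λʳ W` of the `sl₂(ℂ)`-module `W`, with the induced (derivation) `sl₂`-action. -/
def IsExtPower (r : ℕ) (W E : Type*) [AddCommGroup W] [Module ℂ W]
    [LieRingModule (sl (Fin 2) ℂ) W] [LieModule ℂ (sl (Fin 2) ℂ) W]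
    [AddCommGroup E] [Module ℂ E]
    [LieRingModule (sl (Fin 2) ℂ) E] [LieModule ℂ (sl (Fin 2) ℂ) E] : Prop :=
  ∃ μ : AlternatingMap ℂ W E (Fin r),
    Submodule.span ℂ (Set.range fun v : Fin r → W => μ v) = ⊤ ∧
    Module.finrank ℂ E = (Module.finrank ℂ W).choose r ∧
    ∀ (x : sl (Fin 2) ℂ) (v : Fin r → W),
      ⁅x, μ v⁆ = ∑ j : Fin r, μ (Function.update v j ⁅x, v j⁆)

/-- `V` is (a model of) `n·W₂`, the direct sum of `n` copies of the `2`-dimensional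
irreducible `sl₂(ℂ)`-representation: `V` is an internal direct sum of `n` irreducible
Lie submodules, each of dimension `2`. -/
def IsNCopiesW2 (n : ℕ) (V : Type*) [AddCommGroup V] [Module ℂ V]
    [LieRingModule (sl (Fin 2) ℂ) V] [LieModule ℂ (sl (Fin 2) ℂ) V] : Prop :=
  ∃ P : Fin n → LieSubmodule ℂ (sl (Fin 2) ℂ) V,
    (DirectSum.IsInternal fun j => (P j).toSubmodule) ∧
    ∀ j, LieModule.IsIrreducible ℂ (sl (Fin 2) ℂ) (P j) ∧
      Module.finrank ℂ (P j) = 2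

namespace S16
set_option linter.unusedSimpArgs false
set_option linter.unusedSectionVars false
open Module LieModule

noncomputable def sh : sl (Fin 2) ℂ := singleSubSingle 0 1 1
noncomputable def se : sl (Fin 2) ℂ := single 0 1 (by decide) 1
noncomputable def sf : sl (Fin 2) ℂ := single 1 0 (by decide) 1

lemma trip : IsSl2Triple sh se sf where
  h_ne_zero := by
    intro h
    have := congrFun (congrFun (congrArg Subtype.val h) 0) 0
    simp [sh, val_singleSubSingle] at this
  lie_e_f := by
    apply Subtype.ext
    rw [sl_bracket]
    ext i j
    fin_cases i <;> fin_cases j <;> simp [sh, se, sf, val_single, val_singleSubSingle, Matrix.mul_apply, Matrix.single_apply]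
  lie_h_e_nsmul := by
    apply Subtype.ext
    rw [sl_bracket]
    ext i j
    fin_cases i <;> fin_cases j <;> simp [sh, se, sf, val_single, val_singleSubSingle, Matrix.mul_apply, Matrix.single_apply]
    norm_num
  lie_h_f_nsmul := by
    apply Subtype.ext
    rw [sl_bracket]
    ext i j
    fin_cases i <;> fin_cases j <;> simp [sh, se, sf, val_single, val_singleSubSingle, Matrix.mul_apply, Matrix.single_apply]
    norm_num

lemma decomp (x : sl (Fin 2) ℂ) : ∃ a b c : ℂ, x = a • sh + b • se + c • sf := by
  refine ⟨x.1 0 0, x.1 0 1, x.1 1 0, ?_⟩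
  have ht : x.1 0 0 + x.1 1 1 = 0 := by
    have := x.2
    have h2 : Matrix.trace x.1 = 0 := this
    simpa [Matrix.trace, Fin.sum_univ_two] using h2
  apply Subtype.ext
  ext i j
  fin_cases i <;> fin_cases j <;> simp [sh, se, sf, val_single, val_singleSubSingle, Matrix.single_apply]
  linear_combination ht

section
variable {M : Type*} [AddCommGroup M] [Module ℂ M]
    [LieRingModule (sl (Fin 2) ℂ) M] [LieModule ℂ (sl (Fin 2) ℂ) M]

/-- build Lie submodule from stability under h e f -/
def mkSub (p : Submodule ℂ M) (hh : ∀ m ∈ p, ⁅sh, m⁆ ∈ p) (he : ∀ m ∈ p, ⁅se, m⁆ ∈ p)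
    (hf : ∀ m ∈ p, ⁅sf, m⁆ ∈ p) : LieSubmodule ℂ (sl (Fin 2) ℂ) M :=
  { p with
    lie_mem := by
      intro x m hm
      obtain ⟨a, b, c, rfl⟩ := decomp x
      simp only [add_lie, smul_lie]
      exact p.add_mem (p.add_mem (p.smul_mem _ (hh m hm)) (p.smul_mem _ (he m hm)))
        (p.smul_mem _ (hf m hm)) }

lemma ef (m : M) : ⁅se, ⁅sf, m⁆⁆ = ⁅sh, m⁆ + ⁅sf, ⁅se, m⁆⁆ := by
  rw [leibniz_lie, trip.lie_e_f]
lemma he_wt {m : M} {k : ℂ} (h : ⁅sh, m⁆ = k • m) : ⁅sh, ⁅se, m⁆⁆ = (k+2) • ⁅se, m⁆ := by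
  rw [leibniz_lie, trip.lie_h_e_smul ℂ, h, lie_smul, smul_lie]; module
lemma hf_wt {m : M} {k : ℂ} (h : ⁅sh, m⁆ = k • m) : ⁅sh, ⁅sf, m⁆⁆ = (k-2) • ⁅sf, m⁆ := by
  rw [leibniz_lie, trip.lie_lie_smul_f ℂ, h, lie_smul, neg_lie, smul_lie]; module

variable [FiniteDimensional ℂ M]

lemma prim_exists {v : M} {k : ℕ} (P : trip.HasPrimitiveVectorWith v (k : ℂ)) :
    ∃ N : LieSubmodule ℂ (sl (Fin 2) ℂ) M, v ∈ N ∧ LieModule.IsIrreducible ℂ (sl (Fin 2) ℂ) N ∧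
      finrank ℂ N = k + 1 := by
  set ψ : ℕ → M := fun i => ((toEnd ℂ (sl (Fin 2) ℂ) M sf) ^ i) v with hψ
  have hne : ∀ i : Fin (k+1), ψ i ≠ 0 := fun i =>
    P.pow_toEnd_f_ne_zero_of_eq_nat rfl (Nat.lt_succ_iff.mp i.2)
  have hz : ψ (k+1) = 0 := P.pow_toEnd_f_eq_zero_of_eq_nat rfl
  have hH : ∀ i, ⁅sh, ψ i⁆ = ((k:ℂ) - 2 * i) • ψ i := P.lie_h_pow_toEnd_f
  have hE : ∀ i, ⁅se, ψ (i+1)⁆ = (((i:ℂ) + 1) * (k - i)) • ψ i := P.lie_e_pow_succ_toEnd_f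
  have hF : ∀ i, ⁅sf, ψ i⁆ = ψ (i+1) := P.lie_f_pow_toEnd_f
  have h0 : ψ 0 = v := by simp [hψ]
  have hli : LinearIndependent ℂ (fun i : Fin (k+1) => ψ i) := by
    refine End.eigenvectors_linearIndependent' (toEnd ℂ (sl (Fin 2) ℂ) M sh)
      (fun i : Fin (k+1) => (k:ℂ) - 2 * (i : ℕ)) ?_ _ ?_
    · intro i j hij
      have : (i : ℂ) = j := by simpa using hij
      exact Fin.ext (by exact_mod_cast this)
    · intro i
      exact ⟨End.mem_eigenspace_iff.mpr (hH i), hne i⟩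
  set p := Submodule.span ℂ (Set.range fun i : Fin (k+1) => ψ i) with hp
  have hmem : ∀ i, i ≤ k → ψ i ∈ p := fun i hi =>
    Submodule.subset_span ⟨⟨i, Nat.lt_succ_of_le hi⟩, rfl⟩
  have stab : ∀ (x : sl (Fin 2) ℂ), (∀ i, i ≤ k → ⁅x, ψ i⁆ ∈ p) → ∀ m ∈ p, ⁅x, m⁆ ∈ p := by
    intro x hx m hm
    have : p ≤ p.comap (toEnd ℂ (sl (Fin 2) ℂ) M x) := by
      conv_lhs => rw [hp]
      rw [Submodule.span_le]
      rintro _ ⟨i, rfl⟩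
      exact hx i (Nat.lt_succ_iff.mp i.2)
    exact this hm
  let N : LieSubmodule ℂ (sl (Fin 2) ℂ) M := mkSub p
    (stab _ fun i hi => by rw [hH]; exact p.smul_mem _ (hmem i hi))
    (stab _ fun i hi => by
      rcases i with _ | i
      · rw [h0, P.lie_e]; exact p.zero_mem
      · rw [hE]; exact p.smul_mem _ (hmem i (by omega)))
    (stab _ fun i hi => by
      rw [hF]
      rcases Nat.lt_or_eq_of_le hi with h | h
      · exact hmem _ h
      · rw [h, hz]; exact p.zero_mem)
  have hNp : ∀ m, m ∈ N ↔ m ∈ p := fun m => Iff.rfl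
  have hvN : v ∈ N := by rw [hNp, ← h0]; exact hmem 0 (Nat.zero_le _)
  -- any nonzero vector reaches v
  have key : ∀ (Q : LieSubmodule ℂ (sl (Fin 2) ℂ) M) (j : ℕ), j ≤ k → ∀ c : ℕ → ℂ,
      (∃ i, i ≤ j ∧ c i ≠ 0) → (∑ i ∈ Finset.range (j+1), c i • ψ i) ∈ Q → v ∈ Q := by
    intro Q j
    induction j with
    | zero =>
      rintro - c ⟨i, hi, hc⟩ hm
      obtain rfl : i = 0 := by omega
      simp only [zero_add, Finset.sum_range_one, h0] at hm
      simpa [hc] using Q.smul_mem (c 0)⁻¹ hm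
    | succ j ih =>
      rintro hj c ⟨i, hi, hc⟩ hm
      by_cases hall : ∃ i, i ≤ j ∧ c (i+1) ≠ 0
      · refine ih (by omega) (fun i => c (i+1) * (((i:ℂ) + 1) * (k - i))) ?_ ?_
        · obtain ⟨i, hi, hc⟩ := hall
          refine ⟨i, hi, ?_⟩
          refine mul_ne_zero hc (mul_ne_zero (by exact_mod_cast Nat.succ_ne_zero i) ?_)
          rw [sub_ne_zero]
          have : k ≠ i := by omega
          exact_mod_cast this
        · have := Q.lie_mem (x := se) hm
          rw [Finset.sum_range_succ', lie_add, lie_smul, h0, P.lie_e, smul_zero, add_zero, lie_sum] at this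
          have h2 : ∑ i ∈ Finset.range (j+1), (c (i+1) * (((i:ℂ) + 1) * (k - i))) • ψ i =
              ∑ i ∈ Finset.range (j+1), ⁅se, c (i+1) • ψ (i+1)⁆ :=
            Finset.sum_congr rfl fun i _ => by rw [lie_smul, hE, smul_smul]
          rw [h2]
          exact this
      · push Not at hall
        have hi0 : i = 0 := by
          rcases i with _ | i
          · rfl
          · exact absurd (hall i (by omega)) hc
        subst hi0
        rw [Finset.sum_range_succ', Finset.sum_eq_zero, zero_add, h0] at hm
        · simpa [hc] using Q.smul_mem (c 0)⁻¹ hm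
        · intro i hi
          rw [hall i (by simpa [Nat.lt_succ_iff] using hi), zero_smul]
  refine ⟨N, hvN, ?_, ?_⟩
  · have : Nontrivial N := ⟨⟨v, hvN⟩, 0, fun h => P.ne_zero (congrArg Subtype.val h)⟩
    refine LieModule.IsIrreducible.mk ?_
    intro Q hQ
    obtain ⟨w, hwQ, hw0⟩ : ∃ w ∈ Q, w ≠ 0 := by
      by_contra! hcon
      exact hQ (le_bot_iff.mp fun w hw => by simpa using hcon w hw)
    have hwp : (w : M) ∈ p := w.2
    obtain ⟨c, hc⟩ := (Submodule.mem_span_range_iff_exists_fun ℂ).mp hwp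
    set Q' : LieSubmodule ℂ (sl (Fin 2) ℂ) M := Q.map N.incl
    have hw' : (w : M) ∈ Q' := ⟨w, hwQ, rfl⟩
    have hvQ : v ∈ Q' := by
      refine key Q' k le_rfl (fun i => if h : i < k+1 then c ⟨i, h⟩ else 0) ?_ ?_
      · by_contra! hcon
        apply hw0
        apply Subtype.ext
        rw [← hc]
        refine Finset.sum_eq_zero fun i _ => ?_
        have := hcon i (Nat.lt_succ_iff.mp i.2)
        simp only [i.2, dite_true] at this
        rw [this, zero_smul]
      · rw [Finset.sum_range]
        have h2 : ∑ i : Fin (k+1), (if h : (i:ℕ) < k+1 then c ⟨i, h⟩ else 0) • ψ i = (w : M) := by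
          rw [← hc]
          exact Finset.sum_congr rfl fun i _ => by rw [dif_pos i.2]
        rw [h2]
        exact hw'
    have hψQ : ∀ i, ψ i ∈ Q' := by
      intro i
      induction i with
      | zero => rwa [h0]
      | succ i ih => rw [← hF]; exact Q'.lie_mem ih
    have hpQ : p ≤ Q'.toSubmodule := by
      rw [hp, Submodule.span_le]
      rintro _ ⟨i, rfl⟩
      exact hψQ i
    rw [eq_top_iff]
    intro y _
    obtain ⟨z, hz, hzy⟩ := hpQ y.2
    have : z = y := Subtype.ext hzy
    rwa [← this]
  · have : finrank ℂ p = k+1 := by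
      rw [hp, finrank_span_eq_card hli, Fintype.card_fin]
    exact this

end
end S16

namespace S16
open Module LieModule

lemma two_dim {M : Type*} [AddCommGroup M] [Module ℂ M]
    [LieRingModule (sl (Fin 2) ℂ) M] [LieModule ℂ (sl (Fin 2) ℂ) M] [FiniteDimensional ℂ M]
    (hi : LieModule.IsIrreducible ℂ (sl (Fin 2) ℂ) M) (h2 : finrank ℂ M = 2) :
    ∃ b : Basis (Fin 2) ℂ M, ⁅sh, b 0⁆ = b 0 ∧ ⁅sh, b 1⁆ = - b 1 := by
  have : Nontrivial M := nontrivial_of_finrank_pos (R := ℂ) (by omega)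
  obtain ⟨μ, v, hv, P⟩ := IsSl2Triple.exists_hasPrimitiveVectorWith (R := ℂ) (M := M) trip
  obtain ⟨k, rfl⟩ := P.exists_nat
  obtain ⟨N, hvN, -, hN⟩ := prim_exists P
  have hT : N = ⊤ := by
    have hb : N ≠ ⊥ := by
      rintro rfl
      exact hv (by simpa using hvN)
    exact (IsSimpleOrder.eq_bot_or_eq_top N).resolve_left hb
  subst hT
  have h3 : finrank ℂ (⊤ : LieSubmodule ℂ (sl (Fin 2) ℂ) M) = finrank ℂ M := finrank_top ℂ M
  obtain rfl : k = 1 := by omega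
  have hh0 : ⁅sh, v⁆ = (1:ℂ) • v := by simpa using P.lie_h
  have hh1 : ⁅sh, ⁅sf, v⁆⁆ = (-1:ℂ) • ⁅sf, v⁆ := by
    rw [hf_wt hh0]; norm_num
  have hne : ⁅sf, v⁆ ≠ 0 := by
    simpa using P.pow_toEnd_f_ne_zero_of_eq_nat (n := 1) rfl (i := 1) le_rfl
  have hli : LinearIndependent ℂ ![v, ⁅sf, v⁆] := by
    refine End.eigenvectors_linearIndependent' (toEnd ℂ (sl (Fin 2) ℂ) M sh) ![(1:ℂ), -1] ?_ _ ?_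
    · intro i j
      fin_cases i <;> fin_cases j <;> norm_num
    · intro i
      fin_cases i
      · exact ⟨End.mem_eigenspace_iff.mpr hh0, hv⟩
      · exact ⟨End.mem_eigenspace_iff.mpr hh1, hne⟩
  refine ⟨basisOfLinearIndependentOfCardEqFinrank hli (by simp [h2]), ?_, ?_⟩
  · simpa using hh0
  · simpa using hh1

lemma basisE {I : Type*} [Fintype I] {V : Type*} [AddCommGroup V] [Module ℂ V] [FiniteDimensional ℂ V]
    [LieRingModule (sl (Fin 2) ℂ) V] [LieModule ℂ (sl (Fin 2) ℂ) V]
    {E : Type*} [AddCommGroup E] [Module ℂ E] [FiniteDimensional ℂ E]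
    [LieRingModule (sl (Fin 2) ℂ) E] [LieModule ℂ (sl (Fin 2) ℂ) E]
    (b : Basis I ℂ V) (s : I → ℤ) (hs : ∀ i, ⁅sh, b i⁆ = (s i : ℂ) • b i)
    (μ : AlternatingMap ℂ V E (Fin 4))
    (hspan : Submodule.span ℂ (Set.range fun v : Fin 4 → V => μ v) = ⊤)
    (hfr : Module.finrank ℂ E = (Module.finrank ℂ V).choose 4)
    (hμ : ∀ (x : sl (Fin 2) ℂ) (v : Fin 4 → V),
      ⁅x, μ v⁆ = ∑ j : Fin 4, μ (Function.update v j ⁅x, v j⁆)) :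
    ∃ B : Basis (Set.powersetCard I 4) ℂ E, ∀ S, ⁅sh, B S⁆ = ((∑ i ∈ S.1, s i : ℤ) : ℂ) • B S := by
  classical
  let _ : LinearOrder I := LinearOrder.lift' (Fintype.equivFin I) (Fintype.equivFin I).injective
  let φ : (⋀[ℂ]^4 V) →ₗ[ℂ] E := exteriorPower.alternatingMapLinearEquiv μ
  have hφ : ∀ v, φ (exteriorPower.ιMulti ℂ 4 v) = μ v :=
    exteriorPower.alternatingMapLinearEquiv_apply_ιMulti μ
  have hsurj : Function.Surjective φ := by
    rw [← LinearMap.range_eq_top, eq_top_iff, ← hspan, Submodule.span_le]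
    rintro _ ⟨v, rfl⟩
    exact ⟨_, hφ v⟩
  have hfr' : finrank ℂ (⋀[ℂ]^4 V) = finrank ℂ E := by
    rw [hfr, exteriorPower.finrank_eq]
  have hinj : Function.Injective φ := (LinearMap.injective_iff_surjective_of_finrank_eq_finrank hfr').mpr hsurj
  let Φ := LinearEquiv.ofBijective φ ⟨hinj, hsurj⟩
  refine ⟨(b.exteriorPower 4).map Φ, fun S => ?_⟩
  have hB : ((b.exteriorPower 4).map Φ) S = μ (b ∘ (Set.powersetCard.ofFinEmbEquiv.symm S)) := by
    rw [Basis.map_apply, exteriorPower.basis_apply]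
    exact hφ _
  rw [hB, hμ]
  have : ∀ j, μ (Function.update (b ∘ (Set.powersetCard.ofFinEmbEquiv.symm S)) j
      ⁅sh, (b ∘ (Set.powersetCard.ofFinEmbEquiv.symm S)) j⁆) =
      (s (Set.powersetCard.ofFinEmbEquiv.symm S j) : ℂ) • μ (b ∘ (Set.powersetCard.ofFinEmbEquiv.symm S)) := by
    intro j
    rw [Function.comp_apply, hs, AlternatingMap.map_update_smul]
    congr 2
    exact Function.update_eq_self j (b ∘ (Set.powersetCard.ofFinEmbEquiv.symm S))
  rw [Finset.sum_congr rfl fun j _ => this j, ← Finset.sum_smul]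
  congr 1
  rw [← Finset.map_orderEmbOfFin_univ S.1 S.2, Finset.sum_map]
  push_cast
  rfl

lemma basisV {n : ℕ} {V : Type*} [AddCommGroup V] [Module ℂ V] [FiniteDimensional ℂ V]
    [LieRingModule (sl (Fin 2) ℂ) V] [LieModule ℂ (sl (Fin 2) ℂ) V]
    (P : Fin n → LieSubmodule ℂ (sl (Fin 2) ℂ) V)
    (hP : DirectSum.IsInternal fun j => (P j).toSubmodule)
    (h : ∀ j, LieModule.IsIrreducible ℂ (sl (Fin 2) ℂ) (P j) ∧ Module.finrank ℂ (P j) = 2) :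
    ∃ b : Basis (Fin n ⊕ Fin n) ℂ V, ∀ i, ⁅sh, b i⁆ = ((Sum.elim (fun _ => 1) (fun _ => -1) i : ℤ) : ℂ) • b i := by
  choose c h0 h1 using fun j => two_dim (h j).1 (h j).2
  let e : (Σ _ : Fin n, Fin 2) ≃ (Fin n ⊕ Fin n) :=
    { toFun := fun x => if x.2 = 0 then Sum.inl x.1 else Sum.inr x.1
      invFun := Sum.elim (fun i => ⟨i, 0⟩) (fun i => ⟨i, 1⟩)
      left_inv := by rintro ⟨i, j⟩; fin_cases j <;> simp
      right_inv := by rintro (i | i) <;> simp }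
  let b0 : Basis (Σ _ : Fin n, Fin 2) ℂ V := hP.collectedBasis (fun j => (c j : Basis (Fin 2) ℂ (P j).toSubmodule))
  have hb0 : ∀ x, b0 x = ((c x.1 x.2 : P x.1) : V) := by
    intro x
    simp [b0, DirectSum.IsInternal.collectedBasis_coe]
  refine ⟨b0.reindex e, ?_⟩
  rintro (i | i)
  · have hL : b0.reindex e (Sum.inl i) = ((c i 0 : P i) : V) := by
      rw [Basis.reindex_apply]; exact hb0 ⟨i, 0⟩
    rw [hL]
    refine (congrArg Subtype.val (h0 i)).trans ?_
    simp
  · have hL : b0.reindex e (Sum.inr i) = ((c i 1 : P i) : V) := by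
      rw [Basis.reindex_apply]; exact hb0 ⟨i, 1⟩
    rw [hL]
    refine (congrArg Subtype.val (h1 i)).trans ?_
    simp

end S16

namespace S16
open Module

lemma card_wt (n p q : ℕ) (hpq : p + q = 4) :
    Nat.card {S : Set.powersetCard (Fin n ⊕ Fin n) 4 //
      (∑ i ∈ S.1, (Sum.elim (fun _ => 1) (fun _ => -1) i : ℤ)) = (p:ℤ) - q} = n.choose p * n.choose q := by
  classical
  have hsum : ∀ S : Finset (Fin n ⊕ Fin n), (∑ i ∈ S, (Sum.elim (fun _ => 1) (fun _ => -1) i : ℤ)) =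
      (S.toLeft.card : ℤ) - S.toRight.card := by
    intro S
    conv_lhs => rw [← Finset.toLeft_disjSum_toRight (u := S)]
    rw [Finset.sum_disjSum]
    simp
    ring
  let e : {S : Set.powersetCard (Fin n ⊕ Fin n) 4 //
      (∑ i ∈ S.1, (Sum.elim (fun _ => 1) (fun _ => -1) i : ℤ)) = (p:ℤ) - q} ≃
      (Finset.powersetCard p (Finset.univ : Finset (Fin n))) × (Finset.powersetCard q (Finset.univ : Finset (Fin n))) :=
    { toFun := fun S => by
        have h1 := S.2
        rw [hsum] at h1
        have h2 : S.1.1.card = 4 := S.1.2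
        rw [← Finset.card_toLeft_add_card_toRight] at h2
        exact ⟨⟨S.1.1.toLeft, by simp; omega⟩, ⟨S.1.1.toRight, by simp; omega⟩⟩
      invFun := fun x => by
        have h1 : x.1.1.card = p := (Finset.mem_powersetCard.mp x.1.2).2
        have h2 : x.2.1.card = q := (Finset.mem_powersetCard.mp x.2.2).2
        exact ⟨⟨x.1.1.disjSum x.2.1, by
          change Finset.card _ = 4
          rw [Finset.card_disjSum]; omega⟩, by rw [hsum]; simp [h1, h2]⟩
      left_inv := by
        intro S
        apply Subtype.ext
        apply Subtype.ext
        simp [Finset.toLeft_disjSum_toRight]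
      right_inv := by
        intro x
        simp }
  rw [Nat.card_congr e, Nat.card_prod]
  simp

lemma wt_cases (n : ℕ) (S : Set.powersetCard (Fin n ⊕ Fin n) 4) :
    ∃ p q : ℕ, p + q = 4 ∧ (∑ i ∈ S.1, (Sum.elim (fun _ => 1) (fun _ => -1) i : ℤ)) = (p:ℤ) - q := by
  refine ⟨S.1.toLeft.card, S.1.toRight.card, ?_, ?_⟩
  · rw [Finset.card_toLeft_add_card_toRight]; exact S.2
  · conv_lhs => rw [← Finset.toLeft_disjSum_toRight (u := S.1)]
    rw [Finset.sum_disjSum]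
    simp
    ring

/-- eigenspaces of a diagonalised endomorphism -/
lemma finrank_eig {J M : Type*} [Finite J] [AddCommGroup M] [Module ℂ M] (B : Basis J ℂ M) (T : End ℂ M)
    (w : J → ℤ) (hT : ∀ j, T (B j) = (w j : ℂ) • B j) (k : ℤ) :
    finrank ℂ (T.eigenspace (k : ℂ)) = Nat.card {j // w j = k} := by
  classical
  have := Fintype.ofFinite J
  have key : T.eigenspace (k : ℂ) = Submodule.span ℂ (Set.range fun j : {j // w j = k} => B j.1) := by
    apply le_antisymm
    · intro x hx
      rw [End.mem_eigenspace_iff] at hx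
      have hc : ∀ j, w j ≠ k → B.repr x j = 0 := by
        intro j hj
        have h1 : T x = ∑ j, (B.repr x j * w j) • B j := by
          conv_lhs => rw [← B.sum_repr x]
          rw [map_sum]
          exact Finset.sum_congr rfl fun j _ => by rw [map_smul, hT, smul_smul]
        have h2 : B.repr (T x) j = B.repr x j * w j := by
          rw [h1, B.repr_sum_self]
        rw [hx] at h2
        simp only [map_smul, Finsupp.smul_apply, smul_eq_mul] at h2
        have h3 : B.repr x j * ((w j : ℂ) - k) = 0 := by linear_combination -h2
        refine (mul_eq_zero.mp h3).resolve_right ?_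
        rw [sub_eq_zero]
        exact_mod_cast hj
      rw [← B.sum_repr x]
      refine Submodule.sum_mem _ fun j _ => ?_
      by_cases hj : w j = k
      · exact Submodule.smul_mem _ _ (Submodule.subset_span ⟨⟨j, hj⟩, rfl⟩)
      · rw [hc j hj, zero_smul]; exact Submodule.zero_mem _
    · rw [Submodule.span_le]
      rintro _ ⟨⟨j, rfl⟩, rfl⟩
      exact End.mem_eigenspace_iff.mpr (hT j)
  have hcard := finrank_span_eq_card (B.linearIndependent.comp _ (Subtype.val_injective : Function.Injective (Subtype.val : {j // w j = k} → J)))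
  rw [key, Nat.card_eq_fintype_card]
  exact hcard

lemma arith (n : ℕ) : n.choose 3 * n.choose 1 = 3 * (n+1).choose 4 + n.choose 4 ∧
    n.choose 2 * n.choose 2 = n * (n+1).choose 3 / 2 + n.choose 3 * n.choose 1 ∧
    (n+n).choose 4 = 2 * n.choose 4 + 2 * (n.choose 3 * n.choose 1) + n.choose 2 * n.choose 2 := by
  have V : (n+n).choose 4 = 2 * n.choose 4 + 2 * (n.choose 3 * n.choose 1) + n.choose 2 * n.choose 2 := by
    rw [Nat.add_choose_eq]
    simp [Finset.Nat.antidiagonal_succ]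
    ring
  have e1 : n.choose 1 = n := Nat.choose_one_right n
  have s3 : (n+1).choose 3 = n.choose 2 + n.choose 3 := Nat.choose_succ_succ n 2
  have s4 : (n+1).choose 4 = n.choose 3 + n.choose 4 := Nat.choose_succ_succ n 3
  have h2 := Nat.choose_succ_right_eq n 1
  have h3 := Nat.choose_succ_right_eq n 2
  have h4 := Nat.choose_succ_right_eq n 3
  simp only [Nat.reduceAdd] at h2 h3 h4
  have A : ∀ m : ℕ, (n.choose m : ℤ) * ((n - m : ℕ) : ℤ) = n.choose m * ((n : ℤ) - m) := by
    intro m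
    rcases le_or_gt m n with h | h
    · rw [Nat.cast_sub h]
    · rw [Nat.choose_eq_zero_of_lt h]; simp
  zify at h2 h3 h4
  rw [A] at h2 h3 h4
  push_cast at h2 h3 h4
  rw [e1] at h2
  refine ⟨?_, ?_, V⟩
  · rw [e1, s4]
    zify
    linear_combination -h4
  · have hd : n * (n+1).choose 3 = 2 * (n.choose 2 * n.choose 2 - n.choose 3 * n.choose 1) ∧ n.choose 3 * n.choose 1 ≤ n.choose 2 * n.choose 2 := by
      have : (n * (n+1).choose 3 : ℤ) = 2 * (n.choose 2 * n.choose 2 - n.choose 3 * n.choose 1) := by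
        rw [e1, s3]
        push_cast
        have : (6:ℤ) * (n * (n.choose 2 + n.choose 3) - 2 * (n.choose 2 * n.choose 2 - n.choose 3 * n)) = 0 := by
          linear_combination (6 * (n:ℤ)) * h3 - 6 * (n.choose 2 : ℤ) * h2
        omega
      have hle : n.choose 3 * n.choose 1 ≤ n.choose 2 * n.choose 2 := by
        zify
        have : (0:ℤ) ≤ n * (n+1).choose 3 := by positivity
        omega
      refine ⟨?_, hle⟩
      zify [hle]
      exact this
    omega

end S16

namespace S16
open Module LieModule

section
variable {M : Type*} [AddCommGroup M] [Module ℂ M]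
    [LieRingModule (sl (Fin 2) ℂ) M] [LieModule ℂ (sl (Fin 2) ℂ) M]

lemma fe (m : M) : ⁅sf, ⁅se, m⁆⁆ = ⁅se, ⁅sf, m⁆⁆ - ⁅sh, m⁆ := by
  rw [ef]; abel

variable (M) in
noncomputable def W (k : ℂ) : Submodule ℂ M := (toEnd ℂ (sl (Fin 2) ℂ) M sh).eigenspace k

lemma mem_W {k : ℂ} {x : M} : x ∈ W M k ↔ ⁅sh, x⁆ = k • x := End.mem_eigenspace_iff

variable (M) in
noncomputable def Pr (k : ℂ) : Submodule ℂ M := W M k ⊓ LinearMap.ker (toEnd ℂ (sl (Fin 2) ℂ) M se)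

lemma mem_Pr {k : ℂ} {x : M} : x ∈ Pr M k ↔ ⁅sh, x⁆ = k • x ∧ ⁅se, x⁆ = 0 := by
  rw [Pr, Submodule.mem_inf, mem_W]; rfl

lemma e_mem {k l : ℂ} {x : M} (h : x ∈ W M k) (hl : k + 2 = l) : ⁅se, x⁆ ∈ W M l := by
  rw [← hl, mem_W]; exact he_wt (mem_W.mp h)
lemma f_mem {k l : ℂ} {x : M} (h : x ∈ W M k) (hl : k - 2 = l) : ⁅sf, x⁆ ∈ W M l := by
  rw [← hl, mem_W]; exact hf_wt (mem_W.mp h)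

lemma e4 (h6 : W M 6 = ⊥) {x : M} (h : x ∈ W M 4) : ⁅se, x⁆ = 0 := by
  have := e_mem h (l := 6) (by norm_num)
  rwa [h6, Submodule.mem_bot] at this

lemma ef4 (h6 : W M 6 = ⊥) {x : M} (h : x ∈ W M 4) : ⁅se, ⁅sf, x⁆⁆ = (4:ℂ) • x := by
  rw [ef, e4 h6 h, lie_zero, add_zero, mem_W.mp h]

lemma fm4 (h6' : W M (-6) = ⊥) {x : M} (h : x ∈ W M (-4)) : ⁅sf, x⁆ = 0 := by
  have := f_mem h (l := -6) (by norm_num)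
  rwa [h6', Submodule.mem_bot] at this

lemma fem4 (h6' : W M (-6) = ⊥) {x : M} (h : x ∈ W M (-4)) : ⁅sf, ⁅se, x⁆⁆ = (4:ℂ) • x := by
  rw [fe, fm4 h6' h, lie_zero, mem_W.mp h]; module

lemma dec2 (h6 : W M 6 = ⊥) {x : M} (h : x ∈ W M 2) : ∃ y ∈ Pr M 2, ∃ z ∈ W M 4, x = y + ⁅sf, z⁆ := by
  have h4 : ⁅se, x⁆ ∈ W M 4 := e_mem h (by norm_num)
  have hz : (1/4:ℂ) • ⁅se, x⁆ ∈ W M 4 := Submodule.smul_mem _ _ h4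
  refine ⟨x - ⁅sf, (1/4:ℂ) • ⁅se, x⁆⁆, mem_Pr.mpr ⟨?_, ?_⟩, _, hz, by abel⟩
  · exact mem_W.mp (Submodule.sub_mem _ h (f_mem hz (by norm_num)))
  · rw [lie_sub, ef4 h6 hz]; module

lemma decm2 (h6' : W M (-6) = ⊥) {x : M} (h : x ∈ W M (-2)) : ∃ y, y ∈ W M (-2) ∧ ⁅sf, y⁆ = 0 ∧ ∃ z ∈ W M (-4), x = y + ⁅se, z⁆ := by
  have h4 : ⁅sf, x⁆ ∈ W M (-4) := f_mem h (by norm_num)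
  have hz : (1/4:ℂ) • ⁅sf, x⁆ ∈ W M (-4) := Submodule.smul_mem _ _ h4
  refine ⟨x - ⁅se, (1/4:ℂ) • ⁅sf, x⁆⁆, ?_, ?_, _, hz, by abel⟩
  · exact (Submodule.sub_mem _ h (e_mem hz (by norm_num)))
  · rw [lie_sub, fem4 h6' hz]; module

lemma surj4 (h6 : W M 6 = ⊥) {y : M} (h : y ∈ W M 4) : ∃ x ∈ W M 2, ⁅se, x⁆ = y := by
  refine ⟨(1/4:ℂ) • ⁅sf, y⁆, Submodule.smul_mem _ _ (f_mem h (by norm_num)), ?_⟩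
  rw [lie_smul, ef4 h6 h]; module

/-- every weight two vector is `e f` of a weight two vector -/
lemma surj2 (h6 : W M 6 = ⊥) {x : M} (h : x ∈ W M 2) : ∃ u ∈ W M 2, ⁅se, ⁅sf, u⁆⁆ = x := by
  obtain ⟨y, hy, z, hz, rfl⟩ := dec2 h6 h
  have hy' := mem_Pr.mp hy
  have hfz : ⁅sf, z⁆ ∈ W M 2 := f_mem hz (by norm_num)
  refine ⟨(1/2:ℂ) • y + (1/6:ℂ) • ⁅sf, z⁆, Submodule.add_mem _ (Submodule.smul_mem _ _ hy.1)
    (Submodule.smul_mem _ _ hfz), ?_⟩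
  have h1 : ⁅se, ⁅sf, y⁆⁆ = (2:ℂ) • y := by rw [ef, hy'.1, hy'.2, lie_zero, add_zero]
  have h2 : ⁅se, ⁅sf, ⁅sf, z⁆⁆⁆ = (6:ℂ) • ⁅sf, z⁆ := by
    rw [ef, ef4 h6 hz, mem_W.mp hfz, lie_smul]; module
  simp only [lie_add, lie_smul, h1, h2]
  module

lemma dec0 (h6 : W M 6 = ⊥) {x : M} (h : x ∈ W M 0) : ∃ y ∈ Pr M 0, ∃ z ∈ W M 2, x = y + ⁅sf, z⁆ := by
  obtain ⟨u, hu, hu'⟩ := surj2 h6 (e_mem h (l := 2) (by norm_num))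
  refine ⟨x - ⁅sf, u⁆, mem_Pr.mpr ⟨?_, ?_⟩, u, hu, by abel⟩
  · exact mem_W.mp (Submodule.sub_mem _ h (f_mem hu (by norm_num)))
  · rw [lie_sub, hu', sub_self]

lemma surjm2 (h6' : W M (-6) = ⊥) {x : M} (h : x ∈ W M (-2)) : ∃ u ∈ W M 0, ⁅sf, u⁆ = x := by
  obtain ⟨y, hy, hfy, z, hz, rfl⟩ := decm2 h6' h
  have hez : ⁅se, z⁆ ∈ W M (-2) := e_mem hz (by norm_num)
  refine ⟨⁅se, (1/2:ℂ) • y + (1/6:ℂ) • ⁅se, z⁆⁆, e_mem (Submodule.add_mem _ (Submodule.smul_mem _ _ hy)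
    (Submodule.smul_mem _ _ hez)) (by norm_num), ?_⟩
  have h1 : ⁅sf, ⁅se, y⁆⁆ = (2:ℂ) • y := by rw [fe, hfy, mem_W.mp hy, lie_zero]; module
  have h2 : ⁅sf, ⁅se, ⁅se, z⁆⁆⁆ = (6:ℂ) • ⁅se, z⁆ := by
    rw [fe, fem4 h6' hz, mem_W.mp hez, lie_smul]; module
  simp only [lie_add, lie_smul, h1, h2]
  module

lemma surjm4 (h6' : W M (-6) = ⊥) {x : M} (h : x ∈ W M (-4)) : ∃ u ∈ W M (-2), ⁅sf, u⁆ = x := by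
  refine ⟨(1/4:ℂ) • ⁅se, x⁆, Submodule.smul_mem _ _ (e_mem h (by norm_num)), ?_⟩
  rw [lie_smul, fem4 h6' h]; module

lemma finrank_Pr [FiniteDimensional ℂ M] {k l : ℂ} (hl : k + 2 = l)
    (hs : ∀ y ∈ W M l, ∃ x ∈ W M k, ⁅se, x⁆ = y) :
    finrank ℂ (Pr M k) + finrank ℂ (W M l) = finrank ℂ (W M k) := by
  let T : W M k →ₗ[ℂ] W M l := (toEnd ℂ (sl (Fin 2) ℂ) M se).restrict fun x hx => e_mem hx hl
  have hT : LinearMap.range T = ⊤ := by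
    rw [LinearMap.range_eq_top]
    rintro ⟨y, hy⟩
    obtain ⟨x, hx, rfl⟩ := hs y hy
    exact ⟨⟨x, hx⟩, rfl⟩
  have h1 := LinearMap.finrank_range_add_finrank_ker T
  rw [hT, finrank_top] at h1
  have h2 : finrank ℂ (LinearMap.ker T) = finrank ℂ (Pr M k) := by
    have : Pr M k = (LinearMap.ker T).map (W M k).subtype := by
      ext x
      constructor
      · intro hx
        exact ⟨⟨x, hx.1⟩, Subtype.ext hx.2, rfl⟩
      · rintro ⟨y, hy, rfl⟩
        exact ⟨y.2, congrArg Subtype.val hy⟩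
    rw [this]
    exact (LinearEquiv.finrank_eq ((LinearMap.ker T).equivMapOfInjective _ (W M k).injective_subtype))
  omega

variable [FiniteDimensional ℂ M]

lemma assemble {a b c : ℕ} (h6 : W M 6 = ⊥) (h6' : W M (-6) = ⊥)
    (hgen : ∀ K : Submodule ℂ M, W M 4 ≤ K → W M 2 ≤ K → W M 0 ≤ K → W M (-2) ≤ K → W M (-4) ≤ K → K = ⊤)
    (d4 : finrank ℂ (W M 4) = c) (d2 : finrank ℂ (W M 2) = b + c) (d0 : finrank ℂ (W M 0) = a + (b + c))
    (dM : finrank ℂ M = a + 3 * b + 5 * c) :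
    ∃ N : Fin (a + b + c) → LieSubmodule ℂ (sl (Fin 2) ℂ) M,
      (DirectSum.IsInternal fun j => (N j).toSubmodule) ∧
      ∀ j, LieModule.IsIrreducible ℂ (sl (Fin 2) ℂ) (N j) ∧
        Module.finrank ℂ (N j) = (if (j : ℕ) < a then 1 else if (j : ℕ) < a + b then 3 else 5) := by
  have p4 : finrank ℂ (Pr M 4) = c := by
    have : Pr M 4 = W M 4 := le_antisymm inf_le_left fun x hx => ⟨hx, e4 h6 hx⟩
    rw [this, d4]
  have p2 : finrank ℂ (Pr M 2) = b := by
    have := finrank_Pr (M := M) (k := 2) (l := 4) (by norm_num) fun y hy => surj4 h6 hy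
    omega
  have p0 : finrank ℂ (Pr M 0) = a := by
    have := finrank_Pr (M := M) (k := 0) (l := 2) (by norm_num) fun y hy => by
      obtain ⟨u, hu, h⟩ := surj2 h6 hy
      exact ⟨_, f_mem hu (by norm_num), h⟩
    omega
  let B4 := finBasisOfFinrankEq ℂ (Pr M 4) p4
  let B2 := finBasisOfFinrankEq ℂ (Pr M 2) p2
  let B0 := finBasisOfFinrankEq ℂ (Pr M 0) p0
  have mk : ∀ (k : ℕ) (κ : ℂ), κ = (k:ℂ) → ∀ v : Pr M κ, v ≠ 0 → ∃ N : LieSubmodule ℂ (sl (Fin 2) ℂ) M,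
      (v : M) ∈ N ∧ LieModule.IsIrreducible ℂ (sl (Fin 2) ℂ) N ∧ finrank ℂ N = k + 1 := by
    rintro k _ rfl v hv
    have := mem_Pr.mp v.2
    exact prim_exists (v := (v:M)) (k := k) ⟨fun h => hv (Subtype.ext h), this.1, this.2⟩
  choose N4 m4 i4 f4 using fun j => mk 4 4 (by norm_num) (B4 j) (B4.ne_zero j)
  choose N2 m2 i2 f2 using fun j => mk 2 2 (by norm_num) (B2 j) (B2.ne_zero j)
  choose N0 m0 i0 f0 using fun j => mk 0 0 (by norm_num) (B0 j) (B0.ne_zero j)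
  let N : Fin (a + b + c) → LieSubmodule ℂ (sl (Fin 2) ℂ) M := Fin.append (Fin.append N0 N2) N4
  have hN : ∀ j, LieModule.IsIrreducible ℂ (sl (Fin 2) ℂ) (N j) ∧
        Module.finrank ℂ (N j) = (if (j : ℕ) < a then 1 else if (j : ℕ) < a + b then 3 else 5) := by
    intro j
    refine Fin.addCases (fun j => ?_) (fun j => ?_) j
    · refine Fin.addCases (fun j => ?_) (fun j => ?_) j
      · have : N (Fin.castAdd c (Fin.castAdd b j)) = N0 j := by simp [N]
        rw [this]
        exact ⟨i0 j, by rw [f0]; simp⟩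
      · have : N (Fin.castAdd c (Fin.natAdd a j)) = N2 j := by simp [N]
        rw [this]
        exact ⟨i2 j, by rw [f2]; simp⟩
    · have : N (Fin.natAdd (a + b) j) = N4 j := by simp [N]
      rw [this]
      refine ⟨i4 j, ?_⟩
      rw [f4, if_neg (by simp; omega), if_neg (by simp)]
  refine ⟨N, ?_, hN⟩
  -- the sum is everything
  let KL : LieSubmodule ℂ (sl (Fin 2) ℂ) M := ⨆ j, N j
  have le0 : Pr M 0 ≤ KL.toSubmodule := by
    intro x hx
    have h1 : ∀ j, ((B0 j : Pr M 0) : M) ∈ KL := fun j => by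
      have : N (Fin.castAdd c (Fin.castAdd b j)) = N0 j := by simp [N]
      exact le_iSup N _ (this ▸ m0 j)
    have h2 := congrArg Subtype.val (B0.sum_repr ⟨x, hx⟩)
    simp only [AddSubmonoidClass.coe_finsetSum, Submodule.coe_smul] at h2
    rw [← h2]
    exact Submodule.sum_mem _ fun j _ => Submodule.smul_mem _ _ (h1 j)
  have le2 : Pr M 2 ≤ KL.toSubmodule := by
    intro x hx
    have h1 : ∀ j, ((B2 j : Pr M 2) : M) ∈ KL := fun j => by
      have : N (Fin.castAdd c (Fin.natAdd a j)) = N2 j := by simp [N]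
      exact le_iSup N _ (this ▸ m2 j)
    have h2 := congrArg Subtype.val (B2.sum_repr ⟨x, hx⟩)
    simp only [AddSubmonoidClass.coe_finsetSum, Submodule.coe_smul] at h2
    rw [← h2]
    exact Submodule.sum_mem _ fun j _ => Submodule.smul_mem _ _ (h1 j)
  have le4 : Pr M 4 ≤ KL.toSubmodule := by
    intro x hx
    have h1 : ∀ j, ((B4 j : Pr M 4) : M) ∈ KL := fun j => by
      have : N (Fin.natAdd (a + b) j) = N4 j := by simp [N]
      exact le_iSup N _ (this ▸ m4 j)
    have h2 := congrArg Subtype.val (B4.sum_repr ⟨x, hx⟩)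
    simp only [AddSubmonoidClass.coe_finsetSum, Submodule.coe_smul] at h2
    rw [← h2]
    exact Submodule.sum_mem _ fun j _ => Submodule.smul_mem _ _ (h1 j)
  have w4 : W M 4 ≤ KL.toSubmodule := fun x hx => le4 ⟨hx, e4 h6 hx⟩
  have w2 : W M 2 ≤ KL.toSubmodule := by
    intro x hx
    obtain ⟨y, hy, z, hz, rfl⟩ := dec2 h6 hx
    exact Submodule.add_mem _ (le2 hy) (KL.lie_mem (w4 hz))
  have w0 : W M 0 ≤ KL.toSubmodule := by
    intro x hx
    obtain ⟨y, hy, z, hz, rfl⟩ := dec0 h6 hx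
    exact Submodule.add_mem _ (le0 hy) (KL.lie_mem (w2 hz))
  have wm2 : W M (-2) ≤ KL.toSubmodule := by
    intro x hx
    obtain ⟨z, hz, rfl⟩ := surjm2 h6' hx
    exact KL.lie_mem (w0 hz)
  have wm4 : W M (-4) ≤ KL.toSubmodule := by
    intro x hx
    obtain ⟨z, hz, rfl⟩ := surjm4 h6' hx
    exact KL.lie_mem (wm2 hz)
  have htop := hgen _ w4 w2 w0 wm2 wm4
  have hsup : (⨆ j, (N j).toSubmodule) = ⊤ := by
    rw [← htop, LieSubmodule.iSup_toSubmodule]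
  have hsurj : Function.Surjective (DirectSum.coeLinearMap fun j => (N j).toSubmodule) := by
    rw [← LinearMap.range_eq_top, DirectSum.range_coeLinearMap, hsup]
  have hfr : finrank ℂ (DirectSum (Fin (a+b+c)) fun j => (N j).toSubmodule) = finrank ℂ M := by
    rw [Module.finrank_directSum, dM]
    have : ∀ j, finrank ℂ (N j).toSubmodule = (if (j : ℕ) < a then 1 else if (j : ℕ) < a + b then 3 else 5) :=
      fun j => (hN j).2
    simp only [this]
    rw [Fin.sum_univ_add, Fin.sum_univ_add]
    have q1 : ∀ i : Fin b, ¬ (a + (i:ℕ) < a) := fun i => by omega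
    have q2 : ∀ i : Fin c, ¬ (a + b + (i:ℕ) < a) := fun i => by omega
    have q3 : ∀ i : Fin c, ¬ (a + b + (i:ℕ) < a + b) := fun i => by omega
    simp [q2]
    ring
  exact ⟨(LinearMap.injective_iff_surjective_of_finrank_eq_finrank hfr).mpr hsurj, hsurj⟩

end
end S16

/-- As `sl₂(ℂ)`-representations,
`Λ⁴ (n W₂) ≅ (n/2)·C(n+1,3)·W₁ ⊕ 3·C(n+1,4)·W₃ ⊕ C(n,4)·W₅`
(note `(n/2)·C(n+1,3) = n·C(n+1,3)/2` is an integer). -/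
theorem stmt16 (n : ℕ)
    {V : Type*} [AddCommGroup V] [Module ℂ V] [FiniteDimensional ℂ V]
    [LieRingModule (sl (Fin 2) ℂ) V] [LieModule ℂ (sl (Fin 2) ℂ) V]
    (hV : IsNCopiesW2 n V)
    {E : Type*} [AddCommGroup E] [Module ℂ E] [FiniteDimensional ℂ E]
    [LieRingModule (sl (Fin 2) ℂ) E] [LieModule ℂ (sl (Fin 2) ℂ) E]
    (hE : IsExtPower 4 V E) :
    ∃ N : Fin (n * (n+1).choose 3 / 2 + 3 * (n+1).choose 4 + n.choose 4) → LieSubmodule ℂ (sl (Fin 2) ℂ) E,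
      (DirectSum.IsInternal fun j => (N j).toSubmodule) ∧
      ∀ j, LieModule.IsIrreducible ℂ (sl (Fin 2) ℂ) (N j) ∧
        Module.finrank ℂ (N j) = (if (j : ℕ) < n * (n+1).choose 3 / 2 then 1 else if (j : ℕ) < n * (n+1).choose 3 / 2 + 3 * (n+1).choose 4 then 3 else 5) := by
  classical
  obtain ⟨P, hP, hPi⟩ := hV
  obtain ⟨μ, hspan, hfr, hμ⟩ := hE
  obtain ⟨bV, hbV⟩ := S16.basisV P hP hPi
  obtain ⟨B, hB⟩ := S16.basisE bV _ hbV μ hspan hfr hμ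
  have hfV : Module.finrank ℂ V = n + n := by
    rw [Module.finrank_eq_card_basis bV]; simp
  rw [hfV] at hfr
  have hd := fun k : ℤ => S16.finrank_eig B (LieModule.toEnd ℂ (sl (Fin 2) ℂ) E S16.sh) _ hB k
  have hW : ∀ (k : ℤ) (κ : ℂ), κ = (k : ℂ) → Module.finrank ℂ (S16.W E κ) =
      Module.finrank ℂ ((LieModule.toEnd ℂ (sl (Fin 2) ℂ) E S16.sh).eigenspace (k : ℂ)) := by
    rintro k _ rfl
    rfl
  obtain ⟨A1, A2, A3⟩ := S16.arith n
  have c4 := S16.card_wt n 4 0 rfl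
  have c2 := S16.card_wt n 3 1 rfl
  have c0 := S16.card_wt n 2 2 rfl
  norm_num only at c4 c2 c0
  have bad : ∀ k : ℤ, (k = 6 ∨ k = -6) →
      S16.W E (k : ℂ) = ⊥ := by
    intro k hk
    rw [← Submodule.finrank_eq_zero (R := ℂ)]
    refine (hd k).trans ?_
    rw [Nat.card_eq_zero]
    left
    refine ⟨fun S => ?_⟩
    obtain ⟨p, q, h1, h2⟩ := S16.wt_cases n S.1
    have h3 := S.2
    rw [h2] at h3
    omega
  refine S16.assemble ?_ ?_ ?_ ?_ ?_ ?_ ?_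
  · simpa using bad 6 (by simp)
  · simpa using bad (-6) (by simp)
  · intro K k4 k2 k0 k2' k4'
    rw [eq_top_iff, ← B.span_eq, Submodule.span_le]
    rintro _ ⟨S, rfl⟩
    obtain ⟨p, q, h1, h2⟩ := S16.wt_cases n S
    have h3 := hB S
    rw [h2] at h3
    have hp : p ≤ 4 := by omega
    obtain rfl : q = 4 - p := by omega
    interval_cases p
    · exact k4' (S16.mem_W.mpr (by rw [h3]; norm_num))
    · exact k2' (S16.mem_W.mpr (by rw [h3]; norm_num))
    · exact k0 (S16.mem_W.mpr (by rw [h3]; norm_num))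
    · exact k2 (S16.mem_W.mpr (by rw [h3]; norm_num))
    · exact k4 (S16.mem_W.mpr (by rw [h3]; norm_num))
  · have := (hW 4 4 (by norm_num)).trans ((hd 4).trans c4)
    simpa using this
  · have := (hW 2 2 (by norm_num)).trans ((hd 2).trans c2)
    rw [A1] at this
    exact this
  · have := (hW 0 0 (by norm_num)).trans ((hd 0).trans c0)
    rw [A2, A1] at this
    exact this
  · rw [hfr, A3, A2, A1]; ring
end

section
/- The number of irreducible sl2(C)-summands of Λ^k (n W_2) for k = 1,…,5 is given by: δ(Λ^1 nW_2) = n, δ(Λ^2 nW_2) = n², δ(Λ^3 nW_2) = n·C(n,2), δ(Λ^4 nW_2) = C(n,2)², δ(Λ^5 nW_2) = C(n,2)·C(n,3). -/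
open LieAlgebra.SpecialLinear

/-- The predicted number of irreducible summands of `Λᵏ (n W₂)` for `k = 1, …, 5`. -/
def deltaWedgeNW2 (n k : ℕ) : ℕ :=
  if k = 1 then n
  else if k = 2 then n ^ 2
  else if k = 3 then n * n.choose 2
  else if k = 4 then (n.choose 2) ^ 2
  else n.choose 2 * n.choose 3


open Module

theorem aux_triple : IsSl2Triple (L := sl (Fin 2) ℂ) (singleSubSingle 0 1 1)
    (single 0 1 (by decide) 1) (single 1 0 (by decide) 1) where
  h_ne_zero := by
    intro h
    have := congrArg (fun x : sl (Fin 2) ℂ => x.val 0 0) h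
    simp at this
  lie_e_f := by
    apply Subtype.ext
    rw [sl_bracket]
    ext i j
    fin_cases i <;> fin_cases j <;> simp [Matrix.mul_apply, Matrix.single]
  lie_h_e_nsmul := by
    apply Subtype.ext
    rw [sl_bracket]
    ext i j
    fin_cases i <;> fin_cases j <;> norm_num [Matrix.mul_apply, Matrix.single]
  lie_h_f_nsmul := by
    apply Subtype.ext
    rw [sl_bracket]
    ext i j
    fin_cases i <;> fin_cases j <;> norm_num [Matrix.mul_apply, Matrix.single]

theorem aux_span (x : sl (Fin 2) ℂ) : x = (x.val 0 0) • (singleSubSingle 0 1 1 : sl (Fin 2) ℂ)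
    + (x.val 0 1) • (single 0 1 (by decide) 1 : sl (Fin 2) ℂ)
    + (x.val 1 0) • (single 1 0 (by decide) 1 : sl (Fin 2) ℂ) := by
  apply Subtype.ext
  have h : Matrix.trace x.val = 0 := x.2
  rw [Matrix.trace_fin_two] at h
  have hdiag : x.val 1 1 = - x.val 0 0 := by linear_combination h
  ext i j
  fin_cases i <;> fin_cases j <;> simp [Matrix.single, hdiag]

/-- The standard semisimple element. -/
noncomputable def auxH : sl (Fin 2) ℂ := singleSubSingle 0 1 1

theorem aux_irr {M : Type*} [AddCommGroup M] [Module ℂ M] [FiniteDimensional ℂ M]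
    [LieRingModule (sl (Fin 2) ℂ) M] [LieModule ℂ (sl (Fin 2) ℂ) M]
    (hM : LieModule.IsIrreducible ℂ (sl (Fin 2) ℂ) M) :
    ∃ (N : ℕ) (b : Basis (Fin (N + 1)) ℂ M),
      ∀ i, ⁅auxH, b i⁆ = ((N : ℂ) - 2 * (i : ℕ)) • b i := by
  have hnt : Nontrivial M := by
    by_contra hcon
    rw [not_nontrivial_iff_subsingleton] at hcon
    have := hM.toNontrivial
    exact not_subsingleton (LieSubmodule ℂ (sl (Fin 2) ℂ) M) inferInstance
  obtain ⟨c, m, hm, P⟩ := aux_triple.exists_hasPrimitiveVectorWith (R := ℂ) (M := M)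
  obtain ⟨N, hN⟩ := P.exists_nat
  set F := LieModule.toEnd ℂ (sl (Fin 2) ℂ) M (single 1 0 (by decide) 1) with hF
  let v : Fin (N + 1) → M := fun i => (F ^ (i : ℕ)) m
  have hv : ∀ i, ⁅auxH, v i⁆ = ((N : ℂ) - 2 * (i : ℕ)) • v i := by
    intro i
    have := P.lie_h_pow_toEnd_f i
    rw [hN] at this
    exact this
  have hz : ∀ i, N < i → (F ^ i) m = 0 := by
    intro i hi
    obtain ⟨j, rfl⟩ := Nat.exists_eq_add_of_lt hi
    have h0 := P.pow_toEnd_f_eq_zero_of_eq_nat hN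
    rw [show N + j + 1 = j + (N + 1) by ring, pow_add, Module.End.mul_apply, h0, map_zero]
  have hmem : ∀ i, (F ^ i) m ∈ Submodule.span ℂ (Set.range v) := by
    intro i
    by_cases hi : N < i
    · rw [hz i hi]; exact zero_mem _
    · exact Submodule.subset_span ⟨⟨i, by omega⟩, rfl⟩
  have hli : LinearIndependent ℂ v := by
    refine Module.End.eigenvectors_linearIndependent'
      (LieModule.toEnd ℂ (sl (Fin 2) ℂ) M auxH) (fun i : Fin (N+1) => (N : ℂ) - 2 * (i : ℕ)) ?_ v ?_
    · intro i j hij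
      simp only [sub_right_inj, mul_eq_mul_left_iff, Nat.cast_inj] at hij
      rcases hij with h | h
      · exact Fin.ext h
      · norm_num at h
    · intro i
      rw [Module.End.hasEigenvector_iff, Module.End.mem_eigenspace_iff]
      exact ⟨hv i, P.pow_toEnd_f_ne_zero_of_eq_nat hN (by omega)⟩
  let S : LieSubmodule ℂ (sl (Fin 2) ℂ) M :=
    { Submodule.span ℂ (Set.range v) with
      lie_mem := by
        intro x y hy
        change y ∈ Submodule.span ℂ (Set.range v) at hy
        change ⁅x, y⁆ ∈ Submodule.span ℂ (Set.range v)
        induction hy using Submodule.span_induction with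
        | zero => simp
        | add u w _ _ hu hw => rw [lie_add]; exact add_mem hu hw
        | smul t u _ hu => rw [lie_smul]; exact Submodule.smul_mem _ t hu
        | mem u hu =>
          obtain ⟨i, rfl⟩ := hu
          rw [aux_span x, add_lie, add_lie, smul_lie, smul_lie, smul_lie]
          refine add_mem (add_mem (Submodule.smul_mem _ _ ?_) (Submodule.smul_mem _ _ ?_))
            (Submodule.smul_mem _ _ ?_)
          · have := hv i
            rw [auxH] at this
            rw [this]
            exact Submodule.smul_mem _ _ (hmem i)
          · obtain ⟨i, hi⟩ := i
            cases i with
            | zero =>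
              have := P.lie_e
              simp only [v, pow_zero, Module.End.one_apply]
              rw [this]; exact zero_mem _
            | succ i =>
              have := P.lie_e_pow_succ_toEnd_f i
              simp only [v]
              rw [this]
              exact Submodule.smul_mem _ _ (hmem i)
          · have := P.lie_f_pow_toEnd_f i
            simp only [v]
            rw [this]
            exact hmem _ }
  have hS : S = ⊤ := by
    refine (hM.eq_bot_or_eq_top S).resolve_left ?_
    intro h
    have h1 : m ∈ S := hmem 0
    rw [h] at h1
    exact hm (by simpa using h1)
  have hsp : ⊤ ≤ Submodule.span ℂ (Set.range v) := by
    intro y _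
    have : y ∈ S := by rw [hS]; trivial
    exact this
  refine ⟨N, Basis.mk hli hsp, ?_⟩
  intro i
  rw [Basis.mk_apply]
  exact hv i

theorem aux_roots {ι M : Type*} [Fintype ι] [AddCommGroup M] [Module ℂ M]
    [FiniteDimensional ℂ M] (T : M →ₗ[ℂ] M) (b : Basis ι ℂ M) (c : ι → ℂ)
    (h : ∀ i, T (b i) = c i • b i) :
    T.charpoly.roots = Finset.univ.val.map c := by
  classical
  have : LinearMap.toMatrix b b T = Matrix.diagonal c := by
    ext i j
    rw [LinearMap.toMatrix_apply, h]
    by_cases hij : i = j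
    · subst hij; simp
    · simp [hij]
  rw [← LinearMap.charpoly_toMatrix T b, this, Matrix.charpoly_diagonal]
  rw [Polynomial.roots_prod _ _ (by
      simp [Finset.prod_ne_zero_iff, Polynomial.X_sub_C_ne_zero])]
  simp

theorem aux_count (n k : ℕ) :
    (Finset.univ.filter fun s : Finset (Fin n ⊕ Fin n) => s.card = k ∧
      ((∑ x ∈ s, Sum.elim (fun _ => (1 : ℂ)) (fun _ => -1) x = 0) ∨
       (∑ x ∈ s, Sum.elim (fun _ => (1 : ℂ)) (fun _ => -1) x = 1))).card =
    n.choose ((k + 1) / 2) * n.choose (k / 2) := by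
  classical
  have : n.choose ((k + 1) / 2) * n.choose (k / 2) =
      ((Finset.powersetCard ((k + 1) / 2) (Finset.univ : Finset (Fin n))) ×ˢ
       (Finset.powersetCard (k / 2) (Finset.univ : Finset (Fin n)))).card := by
    simp [Finset.card_product]
  rw [this]
  refine Finset.card_bij' (fun s _ => (s.toLeft, s.toRight)) (fun p _ => p.1.disjSum p.2) ?_ ?_ ?_ ?_
  · intro s hs
    simp only [Finset.mem_filter, Finset.mem_univ, true_and] at hs
    obtain ⟨h1, h2⟩ := hs
    rw [← Finset.card_toLeft_add_card_toRight] at h1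
    have h3 : ∑ x ∈ s, Sum.elim (fun _ => (1 : ℂ)) (fun _ => -1) x =
        (((s.toLeft.card : ℤ) - s.toRight.card : ℤ) : ℂ) := by
      conv_lhs => rw [← Finset.toLeft_disjSum_toRight (u := s)]
      rw [Finset.sum_disjSum]
      simp [sub_eq_add_neg]
    rw [h3] at h2
    have h4 : ((s.toLeft.card : ℤ) - s.toRight.card) = 0 ∨
        ((s.toLeft.card : ℤ) - s.toRight.card) = 1 := by exact_mod_cast h2
    simp only [Finset.mem_product, Finset.mem_powersetCard, Finset.subset_univ, true_and]
    omega
  · intro p hp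
    simp only [Finset.mem_product, Finset.mem_powersetCard, Finset.subset_univ, true_and] at hp
    simp only [Finset.mem_filter, Finset.mem_univ, true_and, Finset.card_disjSum,
      Finset.sum_disjSum]
    refine ⟨by omega, ?_⟩
    simp only [Sum.elim_inl, Sum.elim_inr, Finset.sum_const, nsmul_eq_mul, mul_one, mul_neg, hp]
    rcases Nat.even_or_odd' k with ⟨t, rfl | rfl⟩
    · left
      rw [show (2 * t + 1) / 2 = t by omega, show (2 * t) / 2 = t by omega]; ring
    · right
      rw [show (2 * t + 1 + 1) / 2 = t + 1 by omega, show (2 * t + 1) / 2 = t by omega]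
      push_cast; ring
  · intro s _
    simp [Finset.toLeft_disjSum_toRight]
  · intro p _
    simp

theorem aux_one (N : ℕ) : (Finset.univ.filter fun i : Fin (N + 1) =>
    ((N : ℂ) - 2 * (i : ℕ) = 0 ∨ (N : ℂ) - 2 * (i : ℕ) = 1)).card = 1 := by
  rw [Finset.card_eq_one]
  refine ⟨⟨N / 2, by omega⟩, ?_⟩
  ext i
  simp only [Finset.mem_filter, Finset.mem_univ, true_and, Finset.mem_singleton, Fin.ext_iff]
  have h0 : ((N : ℂ) - 2 * (i : ℕ) = 0) ↔ ((N : ℤ) - 2 * (i : ℕ) = 0) := by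
    rw [← Int.cast_inj (α := ℂ)]; push_cast; rfl
  have h1 : ((N : ℂ) - 2 * (i : ℕ) = 1) ↔ ((N : ℤ) - 2 * (i : ℕ) = 1) := by
    rw [← Int.cast_inj (α := ℂ)]; push_cast; rfl
  rw [h0, h1]
  omega

theorem aux_V {n : ℕ} {V : Type*} [AddCommGroup V] [Module ℂ V] [FiniteDimensional ℂ V]
    [LieRingModule (sl (Fin 2) ℂ) V] [LieModule ℂ (sl (Fin 2) ℂ) V]
    (hV : IsNCopiesW2 n V) : ∃ b : Basis (Fin n ⊕ Fin n) ℂ V,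
      ∀ i, ⁅auxH, b i⁆ = (Sum.elim (fun _ => (1 : ℂ)) (fun _ => -1) i) • b i := by
  classical
  obtain ⟨P, hP, hirr⟩ := hV
  have key : ∀ j, ∃ b : Basis (Fin 2) ℂ (P j).toSubmodule,
      ∀ i, ⁅auxH, (b i : V)⁆ = ((1 : ℂ) - 2 * (i : ℕ)) • (b i : V) := by
    intro j
    obtain ⟨h1, h2⟩ := hirr j
    obtain ⟨N, b, hb⟩ := aux_irr h1
    have hN : N = 1 := by
      rw [Module.finrank_eq_card_basis b, Fintype.card_fin] at h2
      omega
    subst hN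
    refine ⟨b, fun i => ?_⟩
    have := congrArg (Subtype.val) (hb i)
    simpa using this
  choose b hb using key
  let B := hP.collectedBasis b
  let e : (Σ _ : Fin n, Fin 2) ≃ Fin n ⊕ Fin n :=
    { toFun := fun x => if x.2 = 0 then Sum.inl x.1 else Sum.inr x.1
      invFun := Sum.elim (fun i => ⟨i, 0⟩) (fun i => ⟨i, 1⟩)
      left_inv := by
        rintro ⟨i, j⟩
        fin_cases j <;> simp
      right_inv := by
        rintro (i | i) <;> simp }
  refine ⟨B.reindex e, ?_⟩
  have hB : ∀ x, B x = (b x.1 x.2 : V) := fun x => by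
    simp [B, DirectSum.IsInternal.collectedBasis_coe]
  rintro (i | i)
  · rw [Basis.reindex_apply, hB]
    have := hb i 0
    rw [show (1 : ℂ) - 2 * ((0 : Fin 2) : ℕ) = 1 by norm_num] at this
    exact this
  · rw [Basis.reindex_apply, hB]
    have := hb i 1
    rw [show (1 : ℂ) - 2 * ((1 : Fin 2) : ℕ) = -1 by norm_num] at this
    exact this

theorem aux_E {I : Type*} [Fintype I] [LinearOrder I] {k : ℕ}
    {V : Type*} [AddCommGroup V] [Module ℂ V] [FiniteDimensional ℂ V]
    [LieRingModule (sl (Fin 2) ℂ) V] [LieModule ℂ (sl (Fin 2) ℂ) V]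
    {E : Type*} [AddCommGroup E] [Module ℂ E] [FiniteDimensional ℂ E]
    [LieRingModule (sl (Fin 2) ℂ) E] [LieModule ℂ (sl (Fin 2) ℂ) E]
    (hE : IsExtPower k V E) (b : Basis I ℂ V) (w : I → ℂ)
    (hb : ∀ i, ⁅auxH, b i⁆ = w i • b i) :
    ∃ B : Basis (Set.powersetCard I k) ℂ E,
      ∀ s, ⁅auxH, B s⁆ = (∑ x ∈ s.val, w x) • B s := by
  obtain ⟨μ, hsp, hrk, hμ⟩ := hE
  let φ := exteriorPower.alternatingMapLinearEquiv μ
  have hφ : ∀ v, φ (exteriorPower.ιMulti ℂ k v) = μ v := fun v =>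
    exteriorPower.alternatingMapLinearEquiv_apply_ιMulti μ v
  have hsurj : Function.Surjective φ := by
    rw [← LinearMap.range_eq_top, eq_top_iff, ← hsp, Submodule.span_le]
    rintro _ ⟨v, rfl⟩
    exact ⟨_, hφ v⟩
  have hfr : Module.finrank ℂ (⋀[ℂ]^k V) = Module.finrank ℂ E := by
    rw [hrk, exteriorPower.finrank_eq]
  have hinj : Function.Injective φ :=
    (LinearMap.injective_iff_surjective_of_finrank_eq_finrank hfr).2 hsurj
  let Φ := LinearEquiv.ofBijective φ ⟨hinj, hsurj⟩
  refine ⟨(b.exteriorPower k).map Φ, fun s => ?_⟩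
  have hBs : (b.exteriorPower k).map Φ s =
      μ (b ∘ Set.powersetCard.ofFinEmbEquiv.symm s) := by
    rw [Basis.map_apply, exteriorPower.basis_apply]
    exact hφ _
  rw [hBs, hμ]
  have : ∀ j : Fin k, μ (Function.update (b ∘ Set.powersetCard.ofFinEmbEquiv.symm s) j
      ⁅auxH, (b ∘ Set.powersetCard.ofFinEmbEquiv.symm s) j⁆) =
      w (Set.powersetCard.ofFinEmbEquiv.symm s j) •
        μ (b ∘ Set.powersetCard.ofFinEmbEquiv.symm s) := by
    intro j
    rw [Function.comp_apply, hb, AlternatingMap.map_update_smul]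
    congr 2
    exact Function.update_eq_self j (b ∘ Set.powersetCard.ofFinEmbEquiv.symm s)
  rw [Finset.sum_congr rfl fun j _ => this j, ← Finset.sum_smul]
  congr 1
  have h2 : s.val = Finset.univ.map (Set.powersetCard.ofFinEmbEquiv.symm s).toEmbedding := by
    ext x
    have := Set.powersetCard.mem_range_ofFinEmbEquiv_symm_iff_mem s x
    rw [Finset.mem_map]
    simp only [Finset.mem_univ, true_and]
    exact this.symm
  conv_rhs => rw [h2, Finset.sum_map]
  rfl

/-- The number of irreducible `sl₂(ℂ)`-summands of `Λᵏ (n W₂)` for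
`k = 1, …, 5` is: `δ(Λ¹ nW₂) = n`, `δ(Λ² nW₂) = n²`, `δ(Λ³ nW₂) = n·C(n,2)`,
`δ(Λ⁴ nW₂) = C(n,2)²`, `δ(Λ⁵ nW₂) = C(n,2)·C(n,3)`. -/
theorem stmt17 (n k : ℕ) (hk1 : 1 ≤ k) (hk5 : k ≤ 5)
    {V : Type*} [AddCommGroup V] [Module ℂ V] [FiniteDimensional ℂ V]
    [LieRingModule (sl (Fin 2) ℂ) V] [LieModule ℂ (sl (Fin 2) ℂ) V]
    (hV : IsNCopiesW2 n V)
    {E : Type*} [AddCommGroup E] [Module ℂ E] [FiniteDimensional ℂ E]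
    [LieRingModule (sl (Fin 2) ℂ) E] [LieModule ℂ (sl (Fin 2) ℂ) E]
    (hE : IsExtPower k V E)
    (d : ℕ) (N : Fin d → LieSubmodule ℂ (sl (Fin 2) ℂ) E)
    (hirr : ∀ j, LieModule.IsIrreducible ℂ (sl (Fin 2) ℂ) (N j))
    (hint : DirectSum.IsInternal fun j => (N j).toSubmodule) :
    d = deltaWedgeNW2 n k := by
  classical
  obtain ⟨b, hb⟩ := aux_V hV
  let _ : LinearOrder (Fin n ⊕ Fin n) := linearOrderOfSTO WellOrderingRel
  obtain ⟨B, hB⟩ := aux_E hE b _ hb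
  choose M c hc using fun j => aux_irr (hirr j)
  let cc : ∀ j, Basis (Fin (M j + 1)) ℂ (N j).toSubmodule := c
  let C := hint.collectedBasis cc
  have hC : ∀ x, ⁅auxH, C x⁆ = ((M x.1 : ℂ) - 2 * (x.2 : ℕ)) • C x := by
    intro x
    have h1 : C x = (cc x.1 x.2 : E) := by
      simp [C, DirectSum.IsInternal.collectedBasis_coe]
    have h2 := congrArg Subtype.val (hc x.1 x.2)
    rw [h1]
    exact h2
  have r1 := aux_roots (LieModule.toEnd ℂ (sl (Fin 2) ℂ) E auxH) B _ hB
  have r2 := aux_roots (LieModule.toEnd ℂ (sl (Fin 2) ℂ) E auxH) C _ hC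
  rw [r1] at r2
  have r3 := congrArg (Multiset.countP fun z : ℂ => z = 0 ∨ z = 1) r2
  rw [Multiset.countP_map, Multiset.countP_map] at r3
  have hd : Multiset.card (Multiset.filter (fun x : Σ j, Fin (M j + 1) =>
      ((M x.1 : ℂ) - 2 * (x.2 : ℕ) = 0 ∨ (M x.1 : ℂ) - 2 * (x.2 : ℕ) = 1))
      Finset.univ.val) = d := by
    change (Finset.univ.filter (fun x : Σ j, Fin (M j + 1) =>
      ((M x.1 : ℂ) - 2 * (x.2 : ℕ) = 0 ∨ (M x.1 : ℂ) - 2 * (x.2 : ℕ) = 1))).card = d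
    rw [Finset.card_filter, Fintype.sum_sigma]
    have : ∀ j : Fin d, (∑ i : Fin (M j + 1), if ((M j : ℂ) - 2 * (i : ℕ) = 0 ∨
        (M j : ℂ) - 2 * (i : ℕ) = 1) then 1 else 0) = 1 := by
      intro j
      rw [← Finset.card_filter, aux_one]
    simp only [this]
    simp
  rw [hd] at r3
  rw [← r3]
  have hcnt := aux_count n k
  have hform : deltaWedgeNW2 n k = n.choose ((k + 1) / 2) * n.choose (k / 2) := by
    interval_cases k <;> simp [deltaWedgeNW2] <;> ring
  rw [hform, ← hcnt]
  change (Finset.univ.filter (fun s : Set.powersetCard (Fin n ⊕ Fin n) k => _)).card = _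
  refine Finset.card_bij (fun s _ => s.val) ?_ ?_ ?_
  · intro s hs
    simp only [Finset.mem_filter, Finset.mem_univ, true_and] at hs ⊢
    exact ⟨s.2, hs⟩
  · intro s _ t _ h
    exact Subtype.ext h
  · intro s hs
    simp only [Finset.mem_filter, Finset.mem_univ, true_and] at hs
    exact ⟨⟨s, hs.1⟩, by simpa using hs.2, rfl⟩
end
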